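/- arXiv:math/9407208 — 6 statements merged into one kernel-verified Lean document; each statement's English description precedes it below -/
import Mathlib

section
/- If ω₁ ≤ κ ≤ λ ≤ 2^{ℵ₀} are cardinals and the meager ideal M on the Cantor space 2^ω is (κ,λ)-nicely generated, then κ = λ. -/
open Cardinal Set

/-- An ideal `I` on a set `X` is `(κ, λ)`-nicely generated if there is a partition
`⟨X_α : α < λ⟩` of `X` into nonempty sets belonging to `I` such that (i) the union of any
fewer than `κ` pieces belongs to `I`, and (ii) every member of `I` is contained in the
union of fewer than `κ` pieces. -/
def NicelyGenerated {X : Type u} (I : Set (Set X)) (κ lam : Cardinal.{u}) : Prop :=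
  ∃ (ι : Type u) (Xs : ι → Set X),
    #ι = lam ∧
    (∀ i, Xs i ∈ I) ∧
    (∀ i, (Xs i).Nonempty) ∧
    (∀ i j, i ≠ j → Disjoint (Xs i) (Xs j)) ∧
    (⋃ i, Xs i) = Set.univ ∧
    (∀ Δ : Set ι, #Δ < κ → (⋃ i ∈ Δ, Xs i) ∈ I) ∧
    (∀ Y ∈ I, ∃ Δ : Set ι, #Δ < κ ∧ Y ⊆ ⋃ i ∈ Δ, Xs i)

open Topology in
/-- Kuratowski–Ulam: for a meagre set in a product with second countable second factor,
the set of points with nonmeagre vertical section is meagre. -/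
theorem IsMeagre.isMeagre_setOf_not_isMeagre_section {X Y : Type*} [TopologicalSpace X]
    [TopologicalSpace Y] [SecondCountableTopology Y] {s : Set (X × Y)} (hs : IsMeagre s) :
    IsMeagre {x : X | ¬ IsMeagre {y : Y | (x, y) ∈ s}} := by
  obtain ⟨S, hSo, hSd, hSc, hSs⟩ := mem_residual_iff.1 hs
  obtain ⟨b, hbc, hbne, hb⟩ := TopologicalSpace.exists_countable_basis Y
  have key : (⋂ U ∈ S, ⋂ V ∈ b, {x : X | ∃ y ∈ V, (x, y) ∈ U}) ∈ residual X := by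
    refine (countable_bInter_mem hSc).2 fun U hU => (countable_bInter_mem hbc).2 fun V hV => ?_
    have himage : {x : X | ∃ y ∈ V, (x, y) ∈ U} = Prod.fst '' (U ∩ Prod.snd ⁻¹' V) := by
      ext x
      constructor
      · rintro ⟨y, hy, hxy⟩
        exact ⟨(x, y), ⟨hxy, hy⟩, rfl⟩
      · rintro ⟨⟨x', y⟩, ⟨hxy, hy⟩, rfl⟩
        exact ⟨y, hy, hxy⟩
    refine residual_of_dense_open ?_ ?_
    · rw [himage]
      exact isOpenMap_fst _ ((hSo U hU).inter ((hb.isOpen hV).preimage continuous_snd))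
    · refine dense_iff_inter_open.2 fun W hW hWne => ?_
      have hVne : V.Nonempty := by
        by_contra hV'
        exact hbne (Set.not_nonempty_iff_eq_empty.1 hV' ▸ hV)
      obtain ⟨⟨x, y⟩, hxy, hU'⟩ :=
        (hSd U hU).inter_open_nonempty _ (hW.prod (hb.isOpen hV)) (hWne.prod hVne)
      exact ⟨x, hxy.1, y, hxy.2, hU'⟩
  refine Filter.mem_of_superset key fun x hx => ?_
  simp only [mem_iInter] at hx
  have hsec : IsMeagre {y : Y | (x, y) ∈ s} := by
    refine Filter.mem_of_superset
      (x := ⋂ U ∈ S, {y : Y | (x, y) ∈ U}) ((countable_bInter_mem hSc).2 fun U hU => ?_) ?_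
    · refine residual_of_dense_open ((hSo U hU).preimage (Continuous.prodMk_right x)) ?_
      refine hb.dense_iff.2 fun V hV _ => ?_
      obtain ⟨y, hy, hxy⟩ := hx U hU V hV
      exact ⟨y, hy, hxy⟩
    · intro y hy
      simp only [mem_iInter] at hy
      exact hSs (mem_sInter.2 fun U hU => hy U hU)
  exact not_not.2 hsec

/-- The Cantor space is homeomorphic to its square. -/
noncomputable def cantorProdHomeomorph : (ℕ → Bool) × (ℕ → Bool) ≃ₜ (ℕ → Bool) :=
  Homeomorph.sumArrowHomeomorphProdArrow.symm.trans
    (Homeomorph.piCongrLeft (Y := fun _ => Bool) Equiv.natSumNatEquivNat)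

theorem Cardinal.mk_sigma_le_of_le {J : Type u} {A : J → Type u} {κ : Cardinal.{u}}
    (hκ : ℵ₀ ≤ κ) (hJ : #J ≤ κ) (hA : ∀ j, #(A j) ≤ κ) : #(Σ j, A j) ≤ κ := by
  rw [mk_sigma]
  exact (sum_le_mk_mul_iSup _).trans
    ((mul_le_mul' hJ (ciSup_le' hA)).trans (mul_eq_self hκ).le)

theorem Cardinal.mk_iUnion_le_of_le {J ι : Type u} {A : J → Set ι} {κ : Cardinal.{u}}
    (hκ : ℵ₀ ≤ κ) (hJ : #J ≤ κ) (hA : ∀ j, #(A j) ≤ κ) : #(⋃ j, A j) ≤ κ :=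
  (mk_iUnion_le_sum_mk.trans (mk_sigma _).ge).trans (mk_sigma_le_of_le hκ hJ hA)

/-- If an infinite `κ` is less than `lam`, then `κ` members of a `(κ, lam)`-nicely generated
ideal do not cover the space. -/
theorem NicelyGenerated.exists_forall_notMem {X : Type u} {I : Set (Set X)}
    {κ lam : Cardinal.{u}} (h : NicelyGenerated I κ lam) (hκ : ℵ₀ ≤ κ) (hlt : κ < lam)
    {J : Type u} (F : J → Set X) (hJ : #J ≤ κ) (hF : ∀ j, F j ∈ I) : ∃ x, ∀ j, x ∉ F j := by
  obtain ⟨ι, Xs, hι, -, hne, hdisj, -, -, hcof⟩ := h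
  choose Δ hΔ hFΔ using fun j => hcof (F j) (hF j)
  have hcard : #(⋃ j, Δ j) ≤ κ := mk_iUnion_le_of_le hκ hJ fun j => (hΔ j).le
  obtain ⟨i, hi⟩ : ∃ i, i ∉ ⋃ j, Δ j := by
    by_contra! hall
    rw [eq_univ_of_forall hall, mk_univ, hι] at hcard
    exact hlt.not_ge hcard
  obtain ⟨x, hx⟩ := hne i
  refine ⟨x, fun j hxj => ?_⟩
  obtain ⟨k, hk, hxk⟩ := mem_iUnion₂.1 (hFΔ j hxj)
  have hik : i = k := by
    by_contra hik
    exact disjoint_left.1 (hdisj i k hik) hx hxk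
  exact hi (mem_iUnion.2 ⟨j, hik ▸ hk⟩)

/-- A family of nonempty sets of size at most `κ`, such that any `κ` indices are missed by some
member, has `κ` pairwise disjoint members. -/
theorem exists_pairwiseDisjoint_mk_eq {X ι : Type u} {κ : Cardinal.{u}} (hκ : ℵ₀ ≤ κ)
    (A : X → Set ι) (hne : ∀ x, (A x).Nonempty) (hA : ∀ x, #(A x) ≤ κ)
    (havoid : ∀ D : Set ι, #D ≤ κ → ∃ x, Disjoint (A x) D) :
    ∃ T : Set X, #T = κ ∧ T.PairwiseDisjoint A := by
  obtain ⟨T, hT⟩ := zorn_subset {T : Set X | T.PairwiseDisjoint A} fun c hc hchain =>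
    ⟨⋃₀ c, (pairwiseDisjoint_sUnion hchain.directedOn).2 hc, fun s => subset_sUnion_of_mem⟩
  have hcard : κ ≤ #T := by
    by_contra! hlt
    obtain ⟨x, hx⟩ := havoid (⋃ t : T, A t) (mk_iUnion_le_of_le hκ hlt.le fun t => hA t)
    have hins : (insert x T).PairwiseDisjoint A :=
      PairwiseDisjoint.insert hT.prop fun t ht _ =>
        hx.mono_right (subset_iUnion (fun t : T => A t) ⟨t, ht⟩)
    have hxT : x ∈ T := hT.le_of_ge hins (subset_insert x T) (mem_insert x T)
    obtain ⟨i, hi⟩ := hne x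
    exact disjoint_left.1 hx hi (mem_iUnion.2 ⟨⟨x, hxT⟩, hi⟩)
  obtain ⟨T', hT', hmk⟩ := le_mk_iff_exists_subset.1 hcard
  exact ⟨T', hmk, PairwiseDisjoint.subset hT.prop hT'⟩

/-- Theorem 5: if `ω₁ ≤ κ ≤ λ ≤ 2^ℵ₀` and the meager ideal on the Cantor space `2^ω`
is `(κ, λ)`-nicely generated, then `κ = λ`. -/
theorem meager_nicelyGenerated_eq (κ lam : Cardinal.{0})
    (h1 : Cardinal.aleph 1 ≤ κ) (h2 : κ ≤ lam) (h3 : lam ≤ 2 ^ Cardinal.aleph0)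
    (h : NicelyGenerated {s : Set (ℕ → Bool) | IsMeagre s} κ lam) :
    κ = lam := by
  by_contra hne
  have hκ : ℵ₀ ≤ κ := (aleph0_le_aleph 1).trans h1
  have hcov := fun (J : Type) (F : J → Set (ℕ → Bool)) =>
    h.exists_forall_notMem hκ (h2.lt_of_ne hne) F
  obtain ⟨ι, Xs, -, hmem, -, hdisj, huniv, -, hcof⟩ := h
  let e := cantorProdHomeomorph
  have hpiece : ∀ z, ∃ i, z ∈ Xs i := fun z => mem_iUnion.1 (huniv ▸ mem_univ z)
  have hsingle : ∀ x : ℕ → Bool, IsMeagre {x} := fun x =>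
    (hpiece x).elim fun i hi => IsMeagre.mono (singleton_subset_iff.2 hi) (hmem i)
  have hstrip : ∀ p : (ℕ → Bool) × (ℕ → Bool) → (ℕ → Bool), Continuous p → IsOpenMap p →
      ∀ x, ∃ Δ : Set ι, #Δ < κ ∧ ∀ q i, p q = x → e q ∈ Xs i → i ∈ Δ := by
    intro p hpc hpo x
    obtain ⟨Δ, hΔ, hsub⟩ := hcof {z | p (e.symm z) = x} <|
      (hsingle x).preimage_of_isOpenMap (hpc.comp e.symm.continuous)
        (hpo.comp e.symm.isOpenMap)
    refine ⟨Δ, hΔ, fun q i hq hi => ?_⟩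
    obtain ⟨k, hk, hqk⟩ := mem_iUnion₂.1 (hsub (show p (e.symm (e q)) = x by simpa using hq))
    by_contra hiΔ
    exact disjoint_left.1 (hdisj i k fun hik => hiΔ (hik ▸ hk)) hi hqk
  have hrow : ∀ x, ∃ Δ : Set ι, #Δ < κ ∧ ∀ y i, e (x, y) ∈ Xs i → i ∈ Δ := fun x =>
    (hstrip Prod.fst continuous_fst isOpenMap_fst x).imp fun Δ hΔ =>
      ⟨hΔ.1, fun y i => hΔ.2 (x, y) i rfl⟩
  have hcol : ∀ y, ∃ Γ : Set ι, #Γ < κ ∧ ∀ x i, e (x, y) ∈ Xs i → i ∈ Γ := fun y =>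
    (hstrip Prod.snd continuous_snd isOpenMap_snd y).imp fun Γ hΓ =>
      ⟨hΓ.1, fun x i => hΓ.2 (x, y) i rfl⟩
  choose Δ hΔ hΔmem using hrow
  let A : (ℕ → Bool) → Set ι := fun x => {i | ¬ IsMeagre {y | e (x, y) ∈ Xs i}}
  have hAΔ : ∀ x, A x ⊆ Δ x := fun x i hi =>
    (nonempty_of_not_isMeagre hi).elim fun y hy => hΔmem x y i hy
  have hAne : ∀ x, (A x).Nonempty := by
    intro x
    by_contra hA
    obtain ⟨y, hy⟩ := hcov (Δ x) (fun i => {y | e (x, y) ∈ Xs i}) (hΔ x).le fun i => by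
      by_contra hi
      exact hA ⟨i, hi⟩
    obtain ⟨i, hi⟩ := hpiece (e (x, y))
    exact hy ⟨i, hΔmem x y i hi⟩ hi
  obtain ⟨T, hT, hTA⟩ := exists_pairwiseDisjoint_mk_eq hκ A hAne
    (fun x => (mk_le_mk_of_subset (hAΔ x)).trans (hΔ x).le) fun D hD => by
      obtain ⟨x, hx⟩ := hcov D (fun i => {x | i.1 ∈ A x}) hD fun i =>
        ((hmem i).preimage_of_isOpenMap e.continuous
          e.isOpenMap).isMeagre_setOf_not_isMeagre_section
      exact ⟨x, disjoint_left.2 fun i hi hiD => hx ⟨i, hiD⟩ hi⟩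
  obtain ⟨y, hy⟩ := hcov (Σ x : T, (Δ x \ A x : Set ι)) (fun p => {y | e (p.1, y) ∈ Xs p.2})
    (mk_sigma_le_of_le hκ hT.le fun x => (mk_le_mk_of_subset sdiff_subset).trans (hΔ x).le)
    fun p => not_not.1 p.2.2.2
  obtain ⟨Γ, hΓ, hΓmem⟩ := hcol y
  choose g hg using fun x : T => hpiece (e (x, y))
  have hgA : ∀ x : T, g x ∈ A x := fun x => by
    by_contra hgx
    exact hy ⟨x, g x, hΔmem x y _ (hg x), hgx⟩ (hg x)
  have hinj : Function.Injective fun x => (⟨g x, hΓmem x _ (hg x)⟩ : Γ) := fun x x' hxx => by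
    have hgg : g x = g x' := congrArg Subtype.val hxx
    exact Subtype.ext (hTA.elim_set x.2 x'.2 _ (hgA x) (hgg ▸ hgA x'))
  exact hΓ.not_ge (hT ▸ mk_le_of_injective hinj)
end

section
/- If ω₁ ≤ κ ≤ λ ≤ 2^{ℵ₀} are cardinals and the null ideal N on the Cantor space 2^ω is (κ,λ)-nicely generated, then κ = λ. -/
open Cardinal Set MeasureTheory

/-- `μ` is the uniform product measure on the Cantor space `2^ω = ℕ → 2`: each basic
cylinder determined by the first `n` coordinates has measure `(1/2)^n`. (This property
determines `μ` uniquely on the Borel = product σ-algebra.) -/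
def IsCantorMeasure (μ : Measure (ℕ → Bool)) : Prop :=
  ∀ (n : ℕ) (s : ℕ → Bool), μ {f | ∀ i < n, f i = s i} = (1 / 2 : ENNReal) ^ n

/-- Interleaving of coordinates, identifying `2^ω × 2^ω` with `2^ω`. -/
def interleave : (ℕ → Bool) × (ℕ → Bool) ≃ᵐ (ℕ → Bool) :=
  (MeasurableEquiv.sumPiEquivProdPi (fun _ : ℕ ⊕ ℕ => Bool)).symm.trans
    (MeasurableEquiv.piCongrLeft (fun _ : ℕ => Bool) Equiv.natSumNatEquivNat)

theorem interleave_two_mul (p : (ℕ → Bool) × (ℕ → Bool)) (n : ℕ) :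
    interleave p (2 * n) = p.1 n :=
  Equiv.piCongrLeft_apply_apply (fun _ : ℕ => Bool) Equiv.natSumNatEquivNat
    ((MeasurableEquiv.sumPiEquivProdPi (fun _ : ℕ ⊕ ℕ => Bool)).symm p) (Sum.inl n)

theorem interleave_two_mul_add_one (p : (ℕ → Bool) × (ℕ → Bool)) (n : ℕ) :
    interleave p (2 * n + 1) = p.2 n :=
  Equiv.piCongrLeft_apply_apply (fun _ : ℕ => Bool) Equiv.natSumNatEquivNat
    ((MeasurableEquiv.sumPiEquivProdPi (fun _ : ℕ ⊕ ℕ => Bool)).symm p) (Sum.inr n)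

namespace IsCantorMeasure

variable {μ ν : Measure (ℕ → Bool)}

theorem isProbabilityMeasure (hμ : IsCantorMeasure μ) : IsProbabilityMeasure μ :=
  ⟨by simpa using hμ 0 fun _ => false⟩

theorem measure_singleton (hμ : IsCantorMeasure μ) (x : ℕ → Bool) : μ {x} = 0 := by
  have hle (n : ℕ) : μ {x} ≤ (1 / 2 : ENNReal) ^ n := by
    rw [← hμ n x]
    exact measure_mono (by rintro _ rfl; simp)
  have hlim : Filter.Tendsto (fun n : ℕ => (1 / 2 : ENNReal) ^ n) Filter.atTop (nhds 0) :=
    ENNReal.tendsto_pow_atTop_nhds_zero_of_lt_one (by simp)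
  exact le_antisymm (ge_of_tendsto' hlim hle) zero_le

theorem unique (hμ : IsCantorMeasure μ) (hν : IsCantorMeasure ν) : μ = ν := by
  have := hμ.isProbabilityMeasure
  have := hν.isProbabilityMeasure
  refine ext_of_generate_finite _
    ((BorelSpace.measurable_eq (α := ℕ → Bool)).trans
      (PiNat.isTopologicalBasis_cylinders (fun _ : ℕ => Bool)).borel_eq_generateFrom) ?_ ?_
    (by simp)
  · rintro _ ⟨x, m, rfl⟩ _ ⟨y, n, rfl⟩ ⟨z, hzx, hzy⟩
    rw [← PiNat.mem_cylinder_iff_eq.1 hzx, ← PiNat.mem_cylinder_iff_eq.1 hzy]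
    refine ⟨z, max m n, ?_⟩
    ext w
    simp only [mem_inter_iff, PiNat.mem_cylinder_iff, lt_max_iff]
    grind
  · rintro _ ⟨x, n, rfl⟩
    exact (hμ n x).trans (hν n x).symm

theorem measurePreserving_interleave (hμ : IsCantorMeasure μ) :
    MeasurePreserving interleave (μ.prod μ) μ := by
  have := hμ.isProbabilityMeasure
  refine ⟨interleave.measurable, unique (fun n s => ?_) hμ⟩
  rw [interleave.map_apply]
  have hpre : interleave ⁻¹' {f | ∀ i < n, f i = s i} =
      {f | ∀ i < (n + 1) / 2, f i = s (2 * i)} ×ˢ {f | ∀ i < n / 2, f i = s (2 * i + 1)} := by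
    ext p
    simp only [mem_preimage, mem_ofPred_eq, mem_prod]
    constructor
    · intro h
      refine ⟨fun i hi => ?_, fun i hi => ?_⟩
      · rw [← interleave_two_mul, h _ (by lia)]
      · rw [← interleave_two_mul_add_one, h _ (by lia)]
    · rintro ⟨h₁, h₂⟩ i hi
      obtain ⟨k, rfl | rfl⟩ := Nat.even_or_odd' i
      · rw [interleave_two_mul, h₁ _ (by lia)]
      · rw [interleave_two_mul_add_one, h₂ _ (by lia)]
  rw [hpre, Measure.prod_prod, hμ _ fun i => s (2 * i), hμ _ fun i => s (2 * i + 1), ← pow_add]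
  congr 1
  lia

end IsCantorMeasure

/-- A nicely generated ideal consists of the sets meeting fewer than `κ` fibres of a map
onto an index set of size `lam`. -/
theorem NicelyGenerated.exists_surjective {X : Type u} {I : Set (Set X)} {κ lam : Cardinal.{u}}
    (h : NicelyGenerated I κ lam) (hI : ∀ s ∈ I, ∀ t ⊆ s, t ∈ I) :
    ∃ (ι : Type u) (c : X → ι), #ι = lam ∧ Function.Surjective c ∧
      ∀ s : Set X, s ∈ I ↔ #(c '' s) < κ := by
  obtain ⟨ι, Xs, hι, -, hne, hdisj, hcov, hsmall, hcof⟩ := h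
  have hmem (x : X) : ∃ i, x ∈ Xs i := mem_iUnion.1 (hcov ▸ mem_univ x)
  choose c hc using hmem
  have huniq {x : X} {i : ι} (hx : x ∈ Xs i) : c x = i := by
    by_contra hne
    exact (hdisj _ _ hne).le_bot ⟨hc x, hx⟩
  refine ⟨ι, c, hι, fun i => (hne i).imp fun _ => huniq, fun s => ⟨fun hs => ?_, fun hs => ?_⟩⟩
  · obtain ⟨Δ, hΔ, hsub⟩ := hcof s hs
    refine (mk_le_mk_of_subset ?_).trans_lt hΔ
    rintro _ ⟨x, hx, rfl⟩
    obtain ⟨i, hi, hxi⟩ := mem_iUnion₂.1 (hsub hx)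
    rwa [huniq hxi]
  · exact hI _ (hsmall _ hs) _ fun x hx => mem_iUnion₂.2 ⟨c x, mem_image_of_mem c hx, hc x⟩

/-- If every set in a family of at most `κ` sets meets fewer than `κ` fibres of a map onto a
set with more than `κ` elements, then the family does not cover. -/
theorem exists_forall_notMem_of_mk_image_lt {X ι J : Type u} {c : X → ι} {κ : Cardinal.{u}}
    (hκ : ℵ₀ ≤ κ) (hc : Function.Surjective c) (hι : κ < #ι) (hJ : #J ≤ κ) (s : J → Set X)
    (hs : ∀ j, #(c '' s j) < κ) : ∃ x, ∀ j, x ∉ s j := by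
  by_contra! hcov
  refine hι.not_ge ?_
  have huniv : ⋃ j, c '' s j = Set.univ := by
    refine eq_univ_of_forall fun i => ?_
    obtain ⟨x, rfl⟩ := hc i
    obtain ⟨j, hj⟩ := hcov x
    exact mem_iUnion.2 ⟨j, mem_image_of_mem c hj⟩
  calc #ι = #(⋃ j, c '' s j) := by rw [huniv, mk_univ]
    _ ≤ #J * ⨆ j, #(c '' s j) := mk_iUnion_le _
    _ ≤ κ * κ := mul_le_mul' hJ (ciSup_le' fun j => (hs j).le)
    _ = κ := mul_eq_self hκ

/-- Theorem 5⋆: if `ω₁ ≤ κ ≤ λ ≤ 2^ℵ₀` and the null ideal on the Cantor space `2^ω`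
(with respect to the uniform product measure) is `(κ, λ)`-nicely generated, then `κ = λ`. -/
theorem null_nicelyGenerated_eq (μ : Measure (ℕ → Bool)) (hμ : IsCantorMeasure μ)
    (κ lam : Cardinal.{0})
    (h1 : Cardinal.aleph 1 ≤ κ) (h2 : κ ≤ lam) (h3 : lam ≤ 2 ^ Cardinal.aleph0)
    (h : NicelyGenerated {s : Set (ℕ → Bool) | μ s = 0} κ lam) :
    κ = lam := by
  have := hμ.isProbabilityMeasure
  have hmp := hμ.measurePreserving_interleave
  have hκ : ℵ₀ ≤ κ := (aleph0_le_aleph 1).trans h1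
  obtain ⟨ι, c, hι, hc, hnull⟩ := h.exists_surjective fun s hs t hts => measure_mono_null hts hs
  simp only [mem_ofPred_eq] at hnull
  by_contra hne
  have hlt : κ < #ι := hι ▸ lt_of_le_of_ne h2 hne
  obtain ⟨T, hT⟩ := le_mk_iff_exists_set.1 hlt.le
  let A : Set (ℕ → Bool) := Function.surjInv hc '' T
  have hA : μ A ≠ 0 := by
    rw [Ne, hnull, image_image]
    simp [Function.surjInv_eq, hT]
  have hrow (a : ℕ → Bool) : μ (interleave '' ({a} ×ˢ Set.univ)) = 0 := by
    rw [interleave.image_eq_preimage_symm, hmp.symm.measure_preimage_equiv, Measure.prod_prod,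
      hμ.measure_singleton, zero_mul]
  have hcol (y : ℕ → Bool) : μ (interleave '' (Set.univ ×ˢ {y})) = 0 := by
    rw [interleave.image_eq_preimage_symm, hmp.symm.measure_preimage_equiv, Measure.prod_prod,
      hμ.measure_singleton, mul_zero]
  let S (a : ℕ → Bool) (i : ι) : Set (ℕ → Bool) := {y | c (interleave (a, y)) = i}
  -- Choose `y` outside all null fibres of the rows indexed by `A`.
  obtain ⟨y, hy⟩ : ∃ y, ∀ a ∈ A, μ (S a (c (interleave (a, y)))) ≠ 0 := by
    let J := Σ a : A, {i : c '' (interleave '' ({a.1} ×ˢ Set.univ)) // μ (S a i) = 0}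
    have hJ : #J ≤ κ := by
      calc #J
          ≤ #A * ⨆ a : A, #{i : c '' (interleave '' ({a.1} ×ˢ Set.univ)) // μ (S a i) = 0} := by
            rw [mk_sigma]
            exact sum_le_mk_mul_iSup _
        _ ≤ κ * κ := mul_le_mul' (hT ▸ mk_image_le) (ciSup_le' fun a =>
            (mk_subtype_le _).trans ((hnull _).1 (hrow a)).le)
        _ = κ := mul_eq_self hκ
    obtain ⟨y, hy⟩ := exists_forall_notMem_of_mk_image_lt hκ hc hlt hJ
      (fun j => S j.1 j.2.1) fun j => (hnull _).1 j.2.2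
    exact ⟨y, fun a ha h0 => hy ⟨⟨a, ha⟩, ⟨_, mem_image_of_mem c
      (mem_image_of_mem interleave (show (a, y) ∈ {a} ×ˢ Set.univ by simp))⟩, h0⟩ rfl⟩
  -- The fibres met by the column of `y` form a null set with non-null rows over `A`.
  let D : Set ι := c '' (interleave '' (Set.univ ×ˢ {y}))
  have hD : μ (c ⁻¹' D) = 0 :=
    (hnull _).2 ((mk_le_mk_of_subset (image_preimage_subset c D)).trans_lt ((hnull _).1 (hcol y)))
  rw [← hmp.measure_preimage_equiv] at hD
  refine hA (measure_mono_null (fun a ha => ?_) (Measure.measure_ae_null_of_prod_null hD))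
  refine fun h0 => hy a ha (measure_mono_null (fun z hz => ?_) h0)
  exact ⟨interleave (a, y), mem_image_of_mem _ (by simp), hz.symm⟩
end

section
/- If the Cantor space 2^ω is partitioned into κ nonempty pairwise disjoint meager sets ⟨X_α : α < κ⟩ (κ an uncountable cardinal) such that every meager subset of 2^ω is contained in the union of countably many of the X_α, then κ = ω₁. -/
open Cardinal Set

open Filter Topology in
/-- The easy half of the Kuratowski–Ulam theorem: almost every vertical section of a meagre set in a
product is meagre. -/
theorem IsMeagre.eventually_isMeagre_section {X Y : Type*} [TopologicalSpace X]
    [TopologicalSpace Y] [SecondCountableTopology Y] {E : Set (X × Y)} (hE : IsMeagre E) :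
    ∀ᶠ x in residual X, IsMeagre {y | (x, y) ∈ E} := by
  obtain ⟨S, hSo, hSd, hSc, hS⟩ := mem_residual_iff.1 hE
  have key : ∀ᶠ x in residual X, ∀ G ∈ S, ∀ V ∈ TopologicalSpace.countableBasis Y,
      ∃ y ∈ V, (x, y) ∈ G := by
    refine (eventually_countable_ball hSc).2 fun G hG ↦
      (eventually_countable_ball (TopologicalSpace.countable_countableBasis Y)).2 fun V hV ↦ ?_
    have hVo := TopologicalSpace.isOpen_of_mem_countableBasis hV
    have hproj : {x | ∃ y ∈ V, (x, y) ∈ G} = Prod.fst '' (G ∩ Set.univ ×ˢ V) := by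
      ext x
      simp [and_comm]
    refine residual_of_dense_open ?_ ?_
    · rw [hproj]
      exact isOpenMap_fst _ ((hSo G hG).inter (isOpen_univ.prod hVo))
    · refine dense_iff_inter_open.2 fun U hU hUne ↦ ?_
      obtain ⟨⟨x, y⟩, ⟨hx, hy⟩, hxy⟩ := (hSd G hG).inter_open_nonempty _ (hU.prod hVo)
        (hUne.prod (TopologicalSpace.nonempty_of_mem_countableBasis hV))
      exact ⟨x, hx, y, hy, hxy⟩
  filter_upwards [key] with x hx
  have hsec : ∀ᶠ y in residual Y, ∀ G ∈ S, (x, y) ∈ G := by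
    refine (eventually_countable_ball hSc).2 fun G hG ↦ ?_
    refine residual_of_dense_open ((hSo G hG).preimage (Continuous.prodMk_right x)) ?_
    refine (TopologicalSpace.isBasis_countableBasis Y).dense_iff.2 fun V hV _ ↦ ?_
    exact hx G hG V hV
  exact mem_of_superset hsec fun y hy ↦ hS hy

/-- Pointwise difference `b ∖ a` of two points of the Cantor space, viewed as subsets of `ℕ`. -/
def cantorDiff (p : (ℕ → Bool) × (ℕ → Bool)) : ℕ → Bool := fun n ↦ !p.1 n && p.2 n

theorem continuous_cantorDiff : Continuous cantorDiff := by
  refine continuous_pi fun n ↦ ?_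
  exact (continuous_of_discreteTopology (f := fun q : Bool × Bool ↦ !q.1 && q.2)).comp
    (by fun_prop : Continuous fun p : (ℕ → Bool) × (ℕ → Bool) ↦ (p.1 n, p.2 n))

theorem isOpenMap_cantorDiff : IsOpenMap cantorDiff := by
  have hpi : IsOpenMap (Pi.map fun (_ : ℕ) (q : Bool × Bool) ↦ !q.1 && q.2) :=
    IsOpenMap.piMap (fun _ _ _ ↦ isOpen_discrete _) (.of_forall fun _ b ↦ ⟨(false, b), by simp⟩)
  have hsplit : IsOpenMap fun (p : (ℕ → Bool) × (ℕ → Bool)) (n : ℕ) ↦ (p.1 n, p.2 n) := by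
    refine Homeomorph.isOpenMap
      { toEquiv := (Equiv.arrowProdEquivProdArrow ℕ (fun _ ↦ Bool) fun _ ↦ Bool).symm
        continuous_toFun := ?_
        continuous_invFun := ?_ }
    · exact continuous_pi fun n ↦
        ((continuous_apply n).comp continuous_fst).prodMk ((continuous_apply n).comp continuous_snd)
    · exact (continuous_pi fun n ↦ continuous_fst.comp (continuous_apply n)).prodMk
        (continuous_pi fun n ↦ continuous_snd.comp (continuous_apply n))
  exact hpi.comp hsplit

theorem IsMeagre.eventually_isMeagre_cantorDiff {M : Set (ℕ → Bool)} (hM : IsMeagre M) :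
    ∀ᶠ a in residual (ℕ → Bool), IsMeagre {b | cantorDiff (a, b) ∈ M} :=
  (hM.preimage_of_isOpenMap continuous_cantorDiff isOpenMap_cantorDiff).eventually_isMeagre_section

/-- The subsets of the complement of `a`, inside the Cantor space. -/
def cantorDisjoint (a : ℕ → Bool) : Set (ℕ → Bool) := {z | ∀ n, a n = true → z n = false}

theorem eventually_isMeagre_cantorDisjoint (h0 : IsMeagre {fun _ : ℕ ↦ false}) :
    ∀ᶠ a in residual (ℕ → Bool), IsMeagre (cantorDisjoint a) := by
  have hcompl : Continuous fun (a : ℕ → Bool) n ↦ !a n :=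
    continuous_pi fun n ↦ (continuous_of_discreteTopology (f := not)).comp (continuous_apply n)
  let e : (ℕ → Bool) ≃ₜ (ℕ → Bool) :=
    { toFun := fun a n ↦ !a n
      invFun := fun a n ↦ !a n
      left_inv := fun a ↦ by simp
      right_inv := fun a ↦ by simp
      continuous_toFun := hcompl
      continuous_invFun := hcompl }
  filter_upwards [(tendsto_residual_of_isOpenMap e.continuous e.isOpenMap).eventually
    h0.eventually_isMeagre_cantorDiff] with a ha
  refine ha.mono fun z hz ↦ ?_
  refine mem_singleton_iff.2 (funext fun n ↦ ?_)
  have hzn := hz n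
  change (!(!a n) && z n) = false
  cases h : a n <;> simp_all

/-- Two generic sets `cantorDisjoint a`, `cantorDisjoint c` meet outside a given meagre set. -/
theorem IsMeagre.exists_cantorDisjoint {M : Set (ℕ → Bool)} (hM : IsMeagre M)
    (h0 : IsMeagre {fun _ : ℕ ↦ false}) :
    ∃ a, IsMeagre (cantorDisjoint a) ∧
      ∀ᶠ c in residual (ℕ → Bool), ∃ z ∈ cantorDisjoint a, z ∈ cantorDisjoint c ∧ z ∉ M := by
  obtain ⟨a, ha, haM⟩ := (dense_of_mem_residual <|
    (eventually_isMeagre_cantorDisjoint h0).and hM.eventually_isMeagre_cantorDiff).nonempty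
  refine ⟨a, ha, ?_⟩
  filter_upwards [haM.eventually_isMeagre_cantorDiff] with c hc
  obtain ⟨w, hw⟩ := (dense_of_mem_residual hc).nonempty
  exact ⟨cantorDiff (a, cantorDiff (c, w)), fun n hn ↦ by simp [cantorDiff, hn],
    fun n hn ↦ by simp [cantorDiff, hn], hw⟩

/-- A closing-off sequence of length `ω₁` for an operator on countable sets. -/
theorem exists_closed_chain {ι : Type*} (G : Set ι → Set ι)
    (hG : ∀ W : Set ι, W.Countable → (G W).Countable) :
    ∃ W : (aleph 1).ord.ToType → Set ι, (∀ ξ, (W ξ).Countable) ∧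
      ∀ η ξ, η < ξ → G (W η) ⊆ W ξ := by
  let F : (ξ : (aleph 1).ord.ToType) → ((η : (aleph 1).ord.ToType) → η < ξ → Set ι) → Set ι :=
    fun ξ w ↦ ⋃ η : Iio ξ, G (w η η.2)
  have hW : ∀ ξ, wellFounded_lt.fix F ξ = ⋃ η : Iio ξ, G (wellFounded_lt.fix F η) :=
    fun ξ ↦ wellFounded_lt.fix_eq F ξ
  refine ⟨wellFounded_lt.fix F, fun ξ ↦ ?_, fun η ξ h ↦ ?_⟩
  · induction ξ using WellFoundedLT.induction with
    | ind ξ ih =>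
      rw [hW]
      have : Countable (Iio ξ) := by
        have h := mk_Iio_lt ξ (by simp)
        rw [mk_ord_toType, lt_aleph_one_iff] at h
        exact mk_le_aleph0_iff.1 h
      exact countable_iUnion fun η ↦ hG _ (ih η η.2)
  · rw [hW ξ]
    exact subset_iUnion (fun η : Iio ξ ↦ G (wellFounded_lt.fix F η)) ⟨η, h⟩

theorem exists_forall_lt_of_countable_omega_one {S : Set (aleph 1).ord.ToType}
    (hS : S.Countable) : ∃ ξ, ∀ η ∈ S, η < ξ := by
  have hc : (⋃ η ∈ S, Iic η).Countable := by
    refine hS.biUnion fun η _ ↦ ?_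
    have h := mk_Iio_lt η (by simp)
    rw [mk_ord_toType, lt_aleph_one_iff] at h
    rw [← Iio_insert]
    exact (le_aleph0_iff_set_countable.1 h).insert _
  have hne : (⋃ η ∈ S, Iic η) ≠ Set.univ := by
    intro h
    rw [h, ← le_aleph0_iff_set_countable, mk_univ, mk_ord_toType] at hc
    exact hc.not_gt aleph0_lt_aleph_one
  obtain ⟨ξ, hξ⟩ := (ne_univ_iff_exists_notMem _).1 hne
  exact ⟨ξ, fun η hη ↦ lt_of_not_ge fun h ↦ hξ (mem_biUnion hη h)⟩

/-- If the Cantor space `2^ω` is partitioned into `κ` nonempty pairwise disjoint meager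
sets (`κ` an uncountable cardinal) such that every meager set is contained in the union
of countably many of the pieces, then `κ = ω₁`. -/
theorem partition_meager_kappa_eq_aleph_one (κ : Cardinal.{0}) (hκ : Cardinal.aleph0 < κ)
    (ι : Type) (hι : #ι = κ) (Xs : ι → Set (ℕ → Bool))
    (hmeager : ∀ i, IsMeagre (Xs i))
    (hne : ∀ i, (Xs i).Nonempty)
    (hdisj : ∀ i j, i ≠ j → Disjoint (Xs i) (Xs j))
    (hcover : (⋃ i, Xs i) = Set.univ)
    (hcof : ∀ Y : Set (ℕ → Bool), IsMeagre Y →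
      ∃ Δ : Set ι, Δ.Countable ∧ Y ⊆ ⋃ i ∈ Δ, Xs i) :
    κ = Cardinal.aleph 1 := by
  have h0 : IsMeagre {fun _ : ℕ ↦ false} := by
    obtain ⟨i, hi⟩ := mem_iUnion.1 (hcover ▸ mem_univ fun _ : ℕ ↦ false)
    exact (hmeager i).mono (singleton_subset_iff.2 hi)
  have heq : ∀ {z i j}, z ∈ Xs i → z ∈ Xs j → i = j := fun {z i j} hi hj ↦
    by_contra fun h ↦ (disjoint_left.1 (hdisj i j h)) hi hj
  choose! Δ hΔc hΔ using hcof
  have hstep : ∀ W : Set ι, ∃ G : Set ι, W.Countable → G.Countable ∧ W ⊆ G ∧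
      IsMeagre {c | ¬ ∃ z ∈ ⋃ i ∈ G, Xs i, z ∈ cantorDisjoint c ∧ z ∉ ⋃ i ∈ W, Xs i} := by
    intro W
    by_cases hW : W.Countable
    · obtain ⟨a, ha, hc⟩ := (isMeagre_biUnion hW fun i _ ↦ hmeager i).exists_cantorDisjoint h0
      refine ⟨W ∪ Δ (cantorDisjoint a), fun _ ↦ ⟨hW.union (hΔc _ ha), subset_union_left, ?_⟩⟩
      rw [IsMeagre]
      filter_upwards [hc] with c ⟨z, hza, hzc, hzW⟩ h
      exact h ⟨z, biUnion_subset_biUnion_left subset_union_right (hΔ _ ha hza), hzc, hzW⟩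
    · exact ⟨∅, fun h ↦ absurd h hW⟩
  choose G hG using hstep
  obtain ⟨W, hWc, hW⟩ := exists_closed_chain G fun W hW ↦ (hG W hW).1
  let N : (aleph 1).ord.ToType → Set (ℕ → Bool) := fun ξ ↦
    {c | ¬ ∃ z ∈ ⋃ i ∈ G (W ξ), Xs i, z ∈ cantorDisjoint c ∧ z ∉ ⋃ i ∈ W ξ, Xs i}
  have hN : ∀ ξ, IsMeagre (N ξ) := fun ξ ↦ (hG _ (hWc ξ)).2.2
  have hbad : IsMeagre {c | ¬ IsMeagre (cantorDisjoint c)} := by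
    rw [IsMeagre]
    filter_upwards [eventually_isMeagre_cantorDisjoint h0] with c hc h using h hc
  have hmem : ∀ c, IsMeagre (cantorDisjoint c) → ∃ ξ, c ∈ N ξ := by
    intro c hc
    have hρ : ∀ i, ∃ η, (∃ η', i ∈ W η') → i ∈ W η := by
      intro i
      by_cases h : ∃ η, i ∈ W η
      · exact h.imp fun η hη _ ↦ hη
      · exact ⟨(exists_forall_lt_of_countable_omega_one countable_empty).choose,
        fun h' ↦ absurd h' h⟩
    choose ρ hρ using hρ
    obtain ⟨ξ, hξ⟩ := exists_forall_lt_of_countable_omega_one ((hΔc _ hc).image ρ)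
    obtain ⟨ξ', hξ'⟩ := exists_forall_lt_of_countable_omega_one (countable_singleton ξ)
    refine ⟨ξ, fun ⟨z, hzG, hzc, hzW⟩ ↦ hzW ?_⟩
    obtain ⟨i, hi, hzi⟩ := mem_iUnion₂.1 hzG
    obtain ⟨j, hj, hzj⟩ := mem_iUnion₂.1 (hΔ _ hc hzc)
    obtain rfl := heq hzi hzj
    have hiρ : i ∈ W (ρ i) := hρ i ⟨ξ', hW ξ ξ' (hξ' ξ rfl) hi⟩
    exact mem_biUnion (hW _ ξ (hξ _ (mem_image_of_mem ρ hj)) ((hG _ (hWc _)).2.1 hiρ)) hzi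
  have hall : (univ : Set ι) ⊆ Δ {c | ¬ IsMeagre (cantorDisjoint c)} ∪ ⋃ ξ, Δ (N ξ) := by
    intro i _
    obtain ⟨c, hci⟩ := hne i
    by_cases hc : IsMeagre (cantorDisjoint c)
    · obtain ⟨ξ, hξ⟩ := hmem c hc
      obtain ⟨j, hj, hcj⟩ := mem_iUnion₂.1 (hΔ _ (hN ξ) hξ)
      exact .inr (mem_iUnion.2 ⟨ξ, heq hci hcj ▸ hj⟩)
    · obtain ⟨j, hj, hcj⟩ := mem_iUnion₂.1 (hΔ _ hbad hc)
      exact .inl (heq hci hcj ▸ hj)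
  refine le_antisymm ?_ (aleph_one_le_iff.2 hκ)
  rw [← hι, ← mk_univ]
  refine (mk_le_mk_of_subset hall).trans <| (mk_union_le _ _).trans <|
    add_le_of_le (aleph0_le_aleph 1) ?_ ?_
  · exact (le_aleph0_iff_set_countable.2 (hΔc _ hbad)).trans (aleph0_le_aleph 1)
  · refine (mk_iUnion_le _).trans (mul_le_of_le (aleph0_le_aleph 1) (by simp) ?_)
    exact ciSup_le' fun ξ ↦
      (le_aleph0_iff_set_countable.2 (hΔc _ (hN ξ))).trans (aleph0_le_aleph 1)
end

section
/- Let κ be a regular uncountable cardinal and let I be an ideal on a set X with ⋃I = X and X ∉ I. If add(I) = cof(I) = κ, then I is (κ,κ)-nicely generated. -/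
open Cardinal Set

universe u

/-- The additivity of an ideal `I`: the least cardinality of a subfamily of `I` whose
union is not in `I`. -/
noncomputable def addIdeal {X : Type u} (I : Set (Set X)) : Cardinal.{u} :=
  sInf {c | ∃ F : Set (Set X), F ⊆ I ∧ ⋃₀ F ∉ I ∧ #F = c}

/-- The cofinality of an ideal `I`: the least cardinality of a subfamily of `I` that is
cofinal in `I` with respect to inclusion. -/
noncomputable def cofIdeal {X : Type u} (I : Set (Set X)) : Cardinal.{u} :=
  sInf {c | ∃ F : Set (Set X), F ⊆ I ∧ (∀ Y ∈ I, ∃ Z ∈ F, Y ⊆ Z) ∧ #F = c}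

/-- Fewer than `addIdeal I` members of `I` have their union in `I`. -/
theorem iUnion_mem_of_lt_addIdeal {X ι : Type u} {I : Set (Set X)} {f : ι → Set X}
    (hf : ∀ i, f i ∈ I) (hι : #ι < addIdeal I) : (⋃ i, f i) ∈ I := by
  by_contra h
  have hle : addIdeal I ≤ #(Set.range f) :=
    csInf_le' ⟨Set.range f, Set.range_subset_iff.2 hf, by rwa [Set.sUnion_range], rfl⟩
  exact (hle.trans Cardinal.mk_range_le).not_gt hι

/-- Some cofinal subfamily of `I` has cardinality `cofIdeal I`. -/
theorem exists_cofinal_mk_eq_cofIdeal {X : Type u} (I : Set (Set X)) :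
    ∃ F ⊆ I, (∀ Y ∈ I, ∃ Z ∈ F, Y ⊆ Z) ∧ #F = cofIdeal I := by
  have h := csInf_mem (s := {c | ∃ F : Set (Set X), F ⊆ I ∧ (∀ Y ∈ I, ∃ Z ∈ F, Y ⊆ Z) ∧ #F = c})
    ⟨#I, I, subset_rfl, fun Y hY => ⟨Y, hY, subset_rfl⟩, rfl⟩
  exact h

/-- Every union along a well-founded relation is the union of its disjointed pieces. -/
theorem exists_mem_diff_iUnion_of_wellFounded {X ι : Type*} {r : ι → ι → Prop}
    (hr : WellFounded r) (f : ι → Set X) {x : X} (hx : ∃ i, x ∈ f i) :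
    ∃ i, x ∈ f i \ ⋃ j ∈ {j | r j i}, f j := by
  obtain ⟨i, hi, hmin⟩ := hr.has_min {i | x ∈ f i} hx
  refine ⟨i, hi, ?_⟩
  simp only [Set.mem_iUnion, not_exists]
  exact fun j hj hxj => hmin j hxj hj

/-- Any ideal `I` on `X` (with `⋃ I = X` and `X ∉ I`) with `add(I) = cof(I) = κ`,
`κ` regular uncountable, is `(κ, κ)`-nicely generated. -/
theorem nicelyGenerated_of_add_eq_cof {X : Type u} (I : Set (Set X)) (κ : Cardinal.{u})
    (hreg : κ.IsRegular) (hunc : Cardinal.aleph 1 ≤ κ)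
    (hdown : ∀ A ∈ I, ∀ B, B ⊆ A → B ∈ I)
    (hcup : ∀ A ∈ I, ∀ B ∈ I, A ∪ B ∈ I)
    (hcover : ⋃₀ I = Set.univ)
    (hproper : Set.univ ∉ I)
    (hadd : addIdeal I = κ) (hcof : cofIdeal I = κ) :
    NicelyGenerated I κ κ := by
  obtain ⟨F, hFI, hFcof, hFcard⟩ := exists_cofinal_mk_eq_cofIdeal I
  rw [hcof] at hFcard
  obtain ⟨r, wo, hord⟩ := Cardinal.exists_ord_eq F
  have hsmall : ∀ a : F, #{b | r b a} < κ := fun a =>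
    hFcard ▸ Cardinal.card_typein_lt (r := r) a hord
  let P : F → Set X := fun a => a.1 \ ⋃ b ∈ {b | r b a}, b.1
  have hPI : ∀ a, P a ∈ I := fun a => hdown _ (hFI a.2) _ Set.sdiff_subset
  have hPcover : ∀ x, ∃ a, x ∈ P a := fun x => by
    obtain ⟨A, hA, hxA⟩ : x ∈ ⋃₀ I := hcover ▸ Set.mem_univ x
    obtain ⟨Z, hZ, hAZ⟩ := hFcof A hA
    exact exists_mem_diff_iUnion_of_wellFounded wo.wf (fun a : F => a.1) ⟨⟨Z, hZ⟩, hAZ hxA⟩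
  have hPnot : ∀ {a b x}, x ∈ P a → r b a → x ∉ b.1 := fun hx hba hxb =>
    hx.2 (Set.mem_biUnion hba hxb)
  have hunion : (⋃ i : {a // (P a).Nonempty}, P i) = Set.univ := by
    refine Set.eq_univ_of_forall fun x => ?_
    obtain ⟨a, ha⟩ := hPcover x
    exact Set.mem_iUnion.2 ⟨⟨a, x, ha⟩, ha⟩
  refine ⟨{a // (P a).Nonempty}, fun i => P i, ?_, fun i => hPI i, fun i => i.2, ?_, hunion,
    ?_, ?_⟩
  · refine le_antisymm (hFcard ▸ Cardinal.mk_subtype_le _) (not_lt.1 fun hlt => hproper ?_)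
    rw [← hunion]
    exact iUnion_mem_of_lt_addIdeal (fun i => hPI i) (hadd ▸ hlt)
  · intro i j hij
    refine Set.disjoint_left.2 fun x hxi hxj => ?_
    rcases trichotomous_of r i.1 j.1 with h | h | h
    · exact hPnot hxj h hxi.1
    · exact hij (Subtype.ext h)
    · exact hPnot hxi h hxj.1
  · intro Δ hΔ
    rw [Set.biUnion_eq_iUnion]
    exact iUnion_mem_of_lt_addIdeal (fun i => hPI i) (hadd ▸ hΔ)
  · intro Y hY
    obtain ⟨Z, hZ, hYZ⟩ := hFcof Y hY
    let z : F := ⟨Z, hZ⟩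
    refine ⟨Subtype.val ⁻¹' insert z {b | r b z}, ?_, fun x hx => ?_⟩
    · refine (Cardinal.mk_preimage_of_injective _ _ Subtype.val_injective).trans_lt ?_
      exact Cardinal.mk_insert_le.trans_lt (Cardinal.add_lt_of_lt hreg.aleph0_le (hsmall z)
        (Cardinal.one_lt_aleph0.trans_le hreg.aleph0_le))
    · obtain ⟨a, ha⟩ := hPcover x
      refine Set.mem_biUnion (x := ⟨a, x, ha⟩) ?_ ha
      rcases trichotomous_of r a z with h | h | h
      · exact Or.inr h
      · exact Or.inl h
      · exact absurd (hYZ hx) (hPnot ha h)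
end

section
/- Let λ be an infinite cardinal and let {A_α : α < λ⁺} be a family of sets each of size < λ. Then there are a set Λ ⊆ λ⁺ of size λ⁺ and a set A of size ≤ λ such that A_α ∩ A_β ⊆ A for all distinct α, β ∈ Λ. -/
open Cardinal Set

universe u

namespace Set

/-- Every indexed family of sets has a maximal pairwise disjoint subfamily. -/
theorem exists_maximal_pairwiseDisjoint {ι α : Type*} (f : ι → Set α) :
    ∃ M : Set ι, Maximal (fun S : Set ι => S.PairwiseDisjoint f) M := by
  refine zorn_subset {S : Set ι | S.PairwiseDisjoint f} fun c hc hchain => ?_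
  exact ⟨⋃₀ c, (pairwiseDisjoint_sUnion hchain.directedOn).2 fun s hs => hc hs,
    fun s hs => subset_sUnion_of_mem hs⟩

end Set

namespace Cardinal

/-- A union of at most `c` many sets of size at most `c` has size at most `c`. -/
theorem mk_iUnion_le_of_le_s7 {α ι : Type u} {c : Cardinal.{u}} (hc : ℵ₀ ≤ c) (hι : #ι ≤ c)
    {f : ι → Set α} (hf : ∀ i, #(f i) ≤ c) : #(⋃ i, f i) ≤ c :=
  calc
    #(⋃ i, f i) ≤ sum fun i => #(f i) := mk_iUnion_le_sum_mk
    _ ≤ sum fun _ : ι => c := sum_le_sum _ _ hf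
    _ = #ι * c := sum_const' ι c
    _ ≤ c * c := mul_le_mul_left hι c
    _ = c := mul_eq_self hc

end Cardinal

/-- Either there is a subfamily of full size
whose pairwise intersections lie in `B`, or a set of size at most `lam` meets every nonempty
`A i \ B`. -/
theorem exists_pairwise_inter_subset_or_exists_meeting_set {α ι : Type u} {lam : Cardinal.{u}}
    (hlam : ℵ₀ ≤ lam) (hι : #ι = Order.succ lam) (A : ι → Set α) (hA : ∀ i, #(A i) ≤ lam)
    (B : Set α) :
    (∃ Λ : Set ι, #Λ = Order.succ lam ∧ ∀ i ∈ Λ, ∀ j ∈ Λ, i ≠ j → A i ∩ A j ⊆ B) ∨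
      ∃ C : Set α, #C ≤ lam ∧ ∀ i, (A i \ B).Nonempty → ((A i \ B) ∩ C).Nonempty := by
  obtain ⟨M, hM, hmax⟩ := exists_maximal_pairwiseDisjoint fun i => A i \ B
  by_cases hcard : #M = Order.succ lam
  · refine .inl ⟨M, hcard, fun i hi j hj hij x hx => ?_⟩
    by_contra hxB
    exact disjoint_left.1 (hM hi hj hij) ⟨hx.1, hxB⟩ ⟨hx.2, hxB⟩
  · have hle : #M ≤ lam :=
      Order.lt_succ_iff.1 (lt_of_le_of_ne ((mk_set_le M).trans hι.le) hcard)
    refine .inr ⟨⋃ i : M, A i, mk_iUnion_le_of_le_s7 hlam hle fun i => hA i, fun i hne => ?_⟩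
    by_contra hempty
    have hdisj : ∀ j ∈ M, Disjoint (A i \ B) (A j \ B) := fun j hj =>
      disjoint_left.2 fun x hxi hxj => hempty ⟨x, hxi, mem_iUnion.2 ⟨⟨j, hj⟩, hxj.1⟩⟩
    have hi : i ∈ M :=
      hmax (hM.insert fun j hj _ => hdisj j hj) (subset_insert i M) (mem_insert i M)
    obtain ⟨x, hx⟩ := hne
    exact hempty ⟨x, hx, mem_iUnion.2 ⟨⟨i, hi⟩, hx.1⟩⟩

/-- If every set of size at most `lam` admits a set of size at most `lam` meeting each member of
the family outside it, then the whole family is covered by a set of size at most `lam`. -/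
theorem exists_superset_of_forall_exists_meeting_set {α ι : Type u} {lam : Cardinal.{u}}
    (hlam : ℵ₀ ≤ lam) (A : ι → Set α) (hA : ∀ i, #(A i) < lam)
    (h : ∀ B : Set α, #B ≤ lam →
      ∃ C : Set α, #C ≤ lam ∧ ∀ i, (A i \ B).Nonempty → ((A i \ B) ∩ C).Nonempty) :
    ∃ B : Set α, #B ≤ lam ∧ ∀ i, A i ⊆ B := by
  choose F hF hmeet using h
  let T := lam.out
  have hT : #T = lam := mk_out lam
  let r : T → T → Prop := WellOrderingRel
  have hr : WellFounded r := IsWellFounded.wf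
  have hunion (t : T) (G : ∀ s, r s t → {S : Set α // #S ≤ lam}) :
      #(⋃ s : {s // r s t}, (G s.1 s.2).1) ≤ lam :=
    mk_iUnion_le_of_le_s7 hlam ((mk_subtype_le _).trans hT.le) fun s => (G s.1 s.2).2
  let step (t : T) (G : ∀ s, r s t → {S : Set α // #S ≤ lam}) : {S : Set α // #S ≤ lam} :=
    ⟨F _ (hunion t G), hF _ (hunion t G)⟩
  let S : T → {S : Set α // #S ≤ lam} := hr.fix step
  have hS (t : T) : S t = step t fun s _ => S s := hr.fix_eq step t
  refine ⟨⋃ t, (S t).1, mk_iUnion_le_of_le_s7 hlam hT.le fun t => (S t).2, fun i => ?_⟩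
  by_contra hsub
  obtain ⟨x, hxA, hx⟩ := not_subset.1 hsub
  have hpoint (t : T) : ∃ y ∈ A i, y ∈ (S t).1 ∧ ∀ s, r s t → y ∉ (S s).1 := by
    obtain ⟨y, ⟨hyA, hyB⟩, hyC⟩ := hmeet _ (hunion t fun s _ => S s) i
      ⟨x, hxA, fun hx' => hx <|
        iUnion_subset (fun s : {s // r s t} => subset_iUnion (fun t => (S t).1) s.1) hx'⟩
    refine ⟨y, hyA, ?_, fun s hs hy => hyB (mem_iUnion.2 ⟨⟨s, hs⟩, hy⟩)⟩
    rw [hS t]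
    exact hyC
  choose y hyA hyS hynew using hpoint
  have hinj : Function.Injective fun t => (⟨y t, hyA t⟩ : A i) := by
    intro s t hst
    have hst : y s = y t := congrArg Subtype.val hst
    rcases trichotomous_of r s t with hlt | heq | hlt
    · exact absurd (hst ▸ hyS s) (hynew t s hlt)
    · exact heq
    · exact absurd (hst ▸ hyS t) (hynew s t hlt)
  exact (hA i).not_ge (hT ▸ mk_le_of_injective hinj)

/-- Lemma 4 (folklore): given a family of `λ⁺` many sets each of size `< λ` (`λ` an
infinite cardinal), there are `λ⁺` many of them whose pairwise intersections are all
contained in a single set of size `≤ λ`. -/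
theorem exists_almost_disjointifying_set {α : Type u} (lam : Cardinal.{u})
    (hlam : Cardinal.aleph0 ≤ lam)
    {ι : Type u} (hι : #ι = Order.succ lam) (A : ι → Set α)
    (hA : ∀ i, #(A i) < lam) :
    ∃ Λ : Set ι, #Λ = Order.succ lam ∧
      ∃ B : Set α, #B ≤ lam ∧
        ∀ i ∈ Λ, ∀ j ∈ Λ, i ≠ j → A i ∩ A j ⊆ B := by
  by_contra hcon
  obtain ⟨B, hB, hAB⟩ := exists_superset_of_forall_exists_meeting_set hlam A hA fun B hB =>
    (exists_pairwise_inter_subset_or_exists_meeting_set hlam hι A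
      (fun i => (hA i).le) B).resolve_left fun ⟨Λ, hΛ, hint⟩ => hcon ⟨Λ, hΛ, B, hB, hint⟩
  exact hcon ⟨univ, mk_univ.trans hι, B, hB, fun i _ _ _ _ => inter_subset_left.trans (hAB i)⟩
end

section
/- Let X be a set, κ ≤ λ ≤ |X| infinite cardinals, and let I be a (κ,λ)-nicely generated ideal on X. Then add(I) = cf(κ), the cofinality of κ. -/
open Cardinal Set

universe u

/-- A union of fewer than `cf κ` sets, each of cardinality less than `κ`, has cardinality less
than `κ`. -/
theorem Cardinal.mk_iUnion_lt_of_lt_cof_ord {α β : Type u} {κ : Cardinal.{u}} (hκ : ℵ₀ ≤ κ)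
    {f : α → Set β} (hα : #α < κ.ord.cof) (hf : ∀ a, #(f a) < κ) : #(⋃ a, f a) < κ :=
  (mk_iUnion_le f).trans_lt <| mul_lt_of_lt hκ (hα.trans_le (Ordinal.cof_ord_le κ))
    (iSup_lt_of_lt_cof_ord hα hf)

/-- A set of cardinality `κ ≥ ℵ₀` is the union of a family, indexed by a type of cardinality
`cf κ`, of sets of cardinality less than `κ`. -/
theorem Cardinal.exists_iUnion_eq_of_mk_eq {β : Type u} {κ : Cardinal.{u}} (hκ : ℵ₀ ≤ κ)
    {T : Set β} (hT : #T = κ) :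
    ∃ (α : Type u) (f : α → Set β), #α = κ.ord.cof ∧ (∀ a, #(f a) < κ) ∧ ⋃ a, f a = T := by
  obtain ⟨S, hS, hScard⟩ := Order.exists_cof_eq κ.ord.ToType
  obtain ⟨e⟩ : Nonempty (κ.ord.ToType ≃ T) := Cardinal.eq.1 (by rw [mk_ord_toType, hT])
  refine ⟨S, fun s ↦ (fun i ↦ (e i : β)) '' Set.Iic s.1, ?_, fun s ↦ ?_, ?_⟩
  · rw [hScard, Ordinal.cof_toType]
  · refine mk_image_le.trans_lt ?_
    simpa using mk_Iic_lt s.1 (by simp) (by simpa using hκ)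
  · ext x
    simp only [Set.mem_iUnion, Set.mem_image, Set.mem_Iic]
    constructor
    · rintro ⟨_, i, -, rfl⟩
      exact (e i).2
    · intro hx
      obtain ⟨s, hs, hle⟩ := hS (e.symm ⟨x, hx⟩)
      exact ⟨⟨s, hs⟩, e.symm ⟨x, hx⟩, hle, by simp⟩

/-- Fact 3 (additivity): if `I` is a `(κ, λ)`-nicely generated ideal on `X`, where
`κ ≤ λ ≤ |X|` are infinite cardinals, then `add(I) = cf(κ)`. -/
theorem addIdeal_of_nicelyGenerated {X : Type u} (I : Set (Set X)) (κ lam : Cardinal.{u})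
    (hκ : Cardinal.aleph0 ≤ κ) (hκlam : κ ≤ lam) (hlam : lam ≤ #X)
    (hdown : ∀ A ∈ I, ∀ B, B ⊆ A → B ∈ I)
    (hcup : ∀ A ∈ I, ∀ B ∈ I, A ∪ B ∈ I)
    (hcover : ⋃₀ I = Set.univ)
    (hproper : Set.univ ∉ I)
    (h : NicelyGenerated I κ lam) :
    addIdeal I = κ.ord.cof := by
  obtain ⟨ι, Xs, hι, -, hne, hdisj, -, hsmall, hcov⟩ := h
  apply le_antisymm
  · obtain ⟨T, hT⟩ := le_mk_iff_exists_set.1 (hκlam.trans_eq hι.symm)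
    obtain ⟨α, f, hα, hf, rfl⟩ := exists_iUnion_eq_of_mk_eq hκ hT
    have hF : addIdeal I ≤ #(Set.range fun a ↦ ⋃ i ∈ f a, Xs i) := by
      refine csInf_le' ⟨_, ?_, fun hmem ↦ ?_, rfl⟩
      · rintro _ ⟨a, rfl⟩
        exact hsmall _ (hf a)
      · obtain ⟨Δ, hΔ, hsub⟩ := hcov _ hmem
        refine (hT.symm.trans_le (mk_le_mk_of_subset fun i hi ↦ ?_)).not_gt hΔ
        obtain ⟨a, ha⟩ := Set.mem_iUnion.1 hi
        obtain ⟨x, hx⟩ := hne i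
        obtain ⟨j, hj, hxj⟩ := Set.mem_iUnion₂.1
          (hsub ⟨_, ⟨a, rfl⟩, Set.mem_iUnion₂.2 ⟨i, ha, hx⟩⟩)
        by_contra hiΔ
        exact Set.disjoint_left.1 (hdisj i j fun hij ↦ hiΔ (hij ▸ hj)) hx hxj
    exact hF.trans (mk_range_le.trans_eq hα)
  · refine le_csInf ⟨_, I, subset_rfl, hcover ▸ hproper, rfl⟩ ?_
    rintro _ ⟨F, hFI, hF, rfl⟩
    by_contra! hlt
    choose! Δ hΔ hsub using hcov
    refine hF (hdown _ (hsmall (⋃ Y : F, Δ Y)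
      (mk_iUnion_lt_of_lt_cof_ord hκ hlt fun Y ↦ hΔ Y (hFI Y.2))) _ ?_)
    rintro x ⟨Y, hY, hx⟩
    obtain ⟨i, hi, hxi⟩ := Set.mem_iUnion₂.1 (hsub Y (hFI hY) hx)
    exact Set.mem_iUnion₂.2 ⟨i, Set.mem_iUnion.2 ⟨⟨Y, hY⟩, hi⟩, hxi⟩
end
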